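/- arXiv:2205.04210 — 5 statements merged into one kernel-verified Lean document; each statement's English description precedes it below -/
import Mathlib

section
/- Let B be a natural number and let [a_1, b_1], ..., [a_n, b_n] be n integer intervals. Then there exists a finite collection P of at most 2n + 1 pairwise disjoint integer intervals whose union is [0, B - 1] and such that for each i, the intersection [a_i, b_i] ∩ [0, B - 1] is a union of members of P. -/
/-- A finite set `S` of cut points splits `[0, N]` into at most `#S + 1` disjoint intervals,
none of which is cut by a point of `S`. -/
theorem exists_interval_partition_of_cuts (N : ℕ) (S : Finset ℕ) :
    ∃ P : Finset (ℕ × ℕ),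
      P.card ≤ S.card + 1 ∧
      (P : Set (ℕ × ℕ)).PairwiseDisjoint (fun p => Set.Icc p.1 p.2) ∧
      (⋃ p ∈ P, Set.Icc p.1 p.2) = Set.Icc 0 N ∧
      ∀ p ∈ P, ∀ c ∈ S, c ≤ p.1 ∨ p.2 < c := by
  classical
  -- `last s` is the right end of the piece that starts at `s`
  let last : ℕ → ℕ := fun s => Nat.findGreatest (fun x => ∀ c ∈ S, c ≤ s ∨ x < c) N
  have last_le (s : ℕ) : last s ≤ N := Nat.findGreatest_le N
  have le_last {s x : ℕ} (hx : x ≤ N) (h : ∀ c ∈ S, c ≤ s ∨ x < c) : x ≤ last s :=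
    Nat.le_findGreatest hx h
  have last_spec {s : ℕ} (hs : s ≤ N) : ∀ c ∈ S, c ≤ s ∨ last s < c :=
    Nat.findGreatest_spec (P := fun x => ∀ c ∈ S, c ≤ s ∨ x < c) hs
      (fun c _ => le_or_gt c s)
  let starts : Finset ℕ := insert 0 (S.filter (· ≤ N))
  have starts_le {s : ℕ} (hs : s ∈ starts) : s ≤ N := by
    simp only [starts, Finset.mem_insert, Finset.mem_filter] at hs
    omega
  have last_lt {s t : ℕ} (hs : s ∈ starts) (ht : t ∈ starts) (hst : s < t) : last s < t := by
    simp only [starts, Finset.mem_insert, Finset.mem_filter] at ht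
    rcases ht with rfl | ⟨ht, -⟩
    · omega
    · rcases last_spec (starts_le hs) t ht with h | h <;> omega
  refine ⟨starts.image fun s => (s, last s), ?_, ?_, ?_, ?_⟩
  · exact Finset.card_image_le.trans <| (Finset.card_insert_le _ _).trans <|
      Nat.succ_le_succ (Finset.card_filter_le _ _)
  · intro p hp q hq hpq
    simp only [Finset.coe_image, Set.mem_image, Finset.mem_coe] at hp hq
    obtain ⟨s, hs, rfl⟩ := hp
    obtain ⟨t, ht, rfl⟩ := hq
    refine Set.disjoint_left.2 fun x hx hy => ?_
    simp only [Set.mem_Icc] at hx hy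
    rcases lt_trichotomy s t with h | rfl | h
    · have := last_lt hs ht h
      omega
    · exact hpq rfl
    · have := last_lt ht hs h
      omega
  · ext x
    simp only [Set.mem_iUnion, Finset.mem_image, Set.mem_Icc, exists_prop]
    constructor
    · rintro ⟨_, ⟨s, -, rfl⟩, -, hx⟩
      exact ⟨x.zero_le, hx.trans (last_le s)⟩
    · rintro ⟨-, hx⟩
      have hs : Nat.findGreatest (· ∈ starts) x ∈ starts :=
        Nat.findGreatest_spec (P := (· ∈ starts)) x.zero_le (Finset.mem_insert_self _ _)
      refine ⟨_, ⟨_, hs, rfl⟩, Nat.findGreatest_le x, le_last hx fun c hc => ?_⟩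
      rcases le_or_gt c x with h | h
      · exact Or.inl <| Nat.le_findGreatest h <|
          Finset.mem_insert_of_mem (Finset.mem_filter.2 ⟨hc, h.trans hx⟩)
      · exact Or.inr h
  · intro p hp
    obtain ⟨s, hs, rfl⟩ := Finset.mem_image.1 hp
    exact last_spec (starts_le hs)

/-- Given `n` integer intervals `[a i, b i]`, there is a refinement of the
address space `[0, B-1]` into at most `2n + 1` pairwise disjoint integer intervals such that
each `[a i, b i] ∩ [0, B-1]` is a union of members of the refinement. -/
theorem interval_refinement (B n : ℕ) (a b : Fin n → ℕ) :
    ∃ P : Finset (ℕ × ℕ),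
      P.card ≤ 2 * n + 1 ∧
      (P : Set (ℕ × ℕ)).PairwiseDisjoint (fun p => Set.Icc p.1 p.2) ∧
      (⋃ p ∈ P, Set.Icc p.1 p.2) = Set.Icc 0 (B - 1) ∧
      ∀ i : Fin n, ∃ T ⊆ P,
        Set.Icc (a i) (b i) ∩ Set.Icc 0 (B - 1) = ⋃ p ∈ T, Set.Icc p.1 p.2 := by
  classical
  let S : Finset ℕ := Finset.univ.image a ∪ Finset.univ.image fun i => b i + 1
  have hS : S.card ≤ 2 * n := by
    have ha : (Finset.univ.image a).card ≤ n := by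
      simpa using Finset.card_image_le (s := Finset.univ) (f := a)
    have hb : (Finset.univ.image fun i => b i + 1).card ≤ n := by
      simpa using Finset.card_image_le (s := Finset.univ) (f := fun i => b i + 1)
    have : S.card ≤ _ := Finset.card_union_le _ _
    omega
  obtain ⟨P, hcard, hdisj, hunion, hcut⟩ := exists_interval_partition_of_cuts (B - 1) S
  refine ⟨P, by omega, hdisj, hunion, fun i =>
    ⟨P.filter fun p => a i ≤ p.1 ∧ p.1 ≤ b i, Finset.filter_subset _ _, ?_⟩⟩
  have ha : a i ∈ S := by simp [S]
  have hb : b i + 1 ∈ S := by simp [S]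
  rw [← hunion]
  ext x
  simp only [Set.mem_inter_iff, Set.mem_iUnion, Set.mem_Icc, Finset.mem_filter, exists_prop]
  constructor
  · rintro ⟨hx, p, hp, hxp⟩
    have := hcut p hp _ ha
    exact ⟨p, ⟨hp, by omega, by omega⟩, hxp⟩
  · rintro ⟨p, ⟨hp, hap, hpb⟩, hxp⟩
    have := hcut p hp _ hb
    exact ⟨⟨by omega, by omega⟩, p, hp, hxp⟩
end

section
/- Let B, d be natural numbers and let R_1, ..., R_n be n boxes in ℕ^d. Then there exists a finite collection Q of at most (2n + 1)^d pairwise disjoint boxes whose union is the full cube [0, B - 1]^d (the set of x : Fin d → ℕ with x i ≤ B - 1 for all i) and such that for each i, the intersection R_i ∩ [0, B - 1]^d is a union of members of Q. -/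
/-- A box in `ℕ^d`: a product of integer intervals (possibly empty). -/
def IsBox {d : ℕ} (s : Set (Fin d → ℕ)) : Prop :=
  ∃ a b : Fin d → ℕ, s = {x | ∀ i, a i ≤ x i ∧ x i ≤ b i}

/-- A bounded order-connected set of natural numbers is a (possibly empty) closed interval. -/
lemma exists_eq_Icc_of_ordConnected {s : Set ℕ} (hs : s.OrdConnected) (hb : BddAbove s) :
    ∃ a b : ℕ, s = Set.Icc a b := by
  rcases s.eq_empty_or_nonempty with rfl | hne
  · exact ⟨1, 0, by simp⟩
  · refine ⟨sInf s, sSup s, Set.Subset.antisymm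
      (fun t ht => ⟨Nat.sInf_le ht, le_csSup hb ht⟩) ?_⟩
    exact hs.out (Nat.sInf_mem hne) (Nat.sSup_mem hne hb)

/-- The number of cut points of `C` that are at most `t`. -/
def cutRank (C : Finset ℕ) (t : ℕ) : ℕ := (C.filter (· ≤ t)).card

lemma cutRank_mono (C : Finset ℕ) : Monotone (cutRank C) := fun _ _ h =>
  Finset.card_le_card (Finset.monotone_filter_right C fun _ _ hc => hc.trans h)

lemma cutRank_le_card (C : Finset ℕ) (t : ℕ) : cutRank C t ≤ C.card :=
  Finset.card_filter_le _ _

lemma le_iff_le_of_cutRank_eq {C : Finset ℕ} {s t c : ℕ} (h : cutRank C s = cutRank C t)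
    (hc : c ∈ C) : c ≤ s ↔ c ≤ t := by
  wlog hst : s ≤ t generalizing s t
  · exact (this h.symm (le_of_not_ge hst)).symm
  have heq : C.filter (· ≤ s) = C.filter (· ≤ t) :=
    Finset.eq_of_subset_of_card_le
      (Finset.monotone_filter_right C fun _ _ hc => hc.trans hst) h.ge
  simpa [hc] using Finset.ext_iff.mp heq c

lemma exists_cutRank_fiber_eq_Icc (C : Finset ℕ) (M k : ℕ) :
    ∃ a b : ℕ, {t | t ≤ M ∧ cutRank C t = k} = Set.Icc a b := by
  refine exists_eq_Icc_of_ordConnected ⟨?_⟩ ⟨M, fun t ht => ht.1⟩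
  rintro x ⟨_, hx⟩ y ⟨hyM, hy⟩ z ⟨hxz, hzy⟩
  exact ⟨hzy.trans hyM,
    le_antisymm (hy ▸ cutRank_mono C hzy) (hx ▸ cutRank_mono C hxz)⟩

/-- The points of the cube `[0, M]^d` whose `j`-th coordinate has rank `k j` among the cut
points `C j`, for every `j`. -/
def gridCell {d : ℕ} (C : Fin d → Finset ℕ) (M : ℕ) (k : Fin d → ℕ) : Set (Fin d → ℕ) :=
  {x | ∀ j, x j ≤ M ∧ cutRank (C j) (x j) = k j}

lemma isBox_gridCell {d : ℕ} (C : Fin d → Finset ℕ) (M : ℕ) (k : Fin d → ℕ) :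
    IsBox (gridCell C M k) := by
  choose a b hab using fun j => exists_cutRank_fiber_eq_Icc (C j) M (k j)
  exact ⟨a, b, Set.ext fun x => forall_congr' fun j => Set.ext_iff.mp (hab j) (x j)⟩

/-- Given `n` boxes in `ℕ^d`, there is a partition of the cube `[0, B-1]^d`
into at most `(2n + 1)^d` pairwise disjoint boxes such that each `R i ∩ [0, B-1]^d`
is a union of members of the partition. -/
theorem box_refinement (B d n : ℕ) (R : Fin n → Set (Fin d → ℕ))
    (hR : ∀ i, IsBox (R i)) :
    ∃ Q : Finset (Set (Fin d → ℕ)),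
      Q.card ≤ (2 * n + 1) ^ d ∧
      (∀ q ∈ Q, IsBox q) ∧
      (Q : Set (Set (Fin d → ℕ))).PairwiseDisjoint id ∧
      ⋃₀ ↑Q = {x : Fin d → ℕ | ∀ i, x i ≤ B - 1} ∧
      ∀ i : Fin n, ∃ T ⊆ Q,
        R i ∩ {x : Fin d → ℕ | ∀ j, x j ≤ B - 1} = ⋃₀ ↑T := by
  classical
  choose a b hab using hR
  let C : Fin d → Finset ℕ := fun j =>
    Finset.univ.image (fun i => a i j) ∪ Finset.univ.image (fun i => b i j + 1)
  have hC : ∀ j, (C j).card ≤ 2 * n := fun j => by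
    have h₁ := Finset.card_image_le (s := Finset.univ) (f := fun i => a i j)
    have h₂ := Finset.card_image_le (s := Finset.univ) (f := fun i => b i j + 1)
    have h₃ := Finset.card_union_le (Finset.univ.image (fun i => a i j))
      (Finset.univ.image (fun i => b i j + 1))
    simp only [Finset.card_univ, Fintype.card_fin] at h₁ h₂
    simp only [C]
    omega
  let cell : (Fin d → Fin (2 * n + 1)) → Set (Fin d → ℕ) := fun k =>
    gridCell C (B - 1) fun j => k j
  let Q : Finset (Set (Fin d → ℕ)) := Finset.univ.image cell
  have exists_cell : ∀ x : Fin d → ℕ, (∀ j, x j ≤ B - 1) → ∃ k, x ∈ cell k := fun x hx =>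
    ⟨fun j => ⟨cutRank (C j) (x j), Nat.lt_succ_of_le ((cutRank_le_card _ _).trans (hC j))⟩,
      fun j => ⟨hx j, rfl⟩⟩
  have cell_subset : ∀ i k x, x ∈ cell k → x ∈ R i → cell k ⊆ R i := by
    intro i k x hxk hxR y hyk
    rw [hab i] at hxR ⊢
    intro j
    have hr : cutRank (C j) (x j) = cutRank (C j) (y j) := (hxk j).2.trans (hyk j).2.symm
    have ha := le_iff_le_of_cutRank_eq hr (c := a i j) (by simp [C])
    have hb := le_iff_le_of_cutRank_eq hr (c := b i j + 1) (by simp [C])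
    have := hxR j
    omega
  refine ⟨Q, ?_, ?_, ?_, ?_, fun i => ⟨Q.filter (· ⊆ R i), Finset.filter_subset _ _, ?_⟩⟩
  · exact Finset.card_image_le.trans (by simp)
  · intro q hq
    obtain ⟨k, -, rfl⟩ := Finset.mem_image.mp hq
    exact isBox_gridCell _ _ _
  · intro p hp q hq hpq
    obtain ⟨k, -, rfl⟩ := Finset.mem_image.mp hp
    obtain ⟨l, -, rfl⟩ := Finset.mem_image.mp hq
    refine Set.disjoint_left.mpr fun x hxk hxl => hpq (congrArg cell (funext fun j => ?_))
    exact Fin.ext ((hxk j).2.symm.trans (hxl j).2)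
  · ext x
    constructor
    · rintro ⟨q, hq, hxq⟩ j
      obtain ⟨k, -, rfl⟩ := Finset.mem_image.mp hq
      exact (hxq j).1
    · intro hx
      obtain ⟨k, hk⟩ := exists_cell x hx
      exact ⟨cell k, Finset.mem_image_of_mem _ (Finset.mem_univ k), hk⟩
  · ext x
    constructor
    · rintro ⟨hxR, hx⟩
      obtain ⟨k, hk⟩ := exists_cell x hx
      exact ⟨cell k, Finset.mem_filter.mpr
        ⟨Finset.mem_image_of_mem _ (Finset.mem_univ k), cell_subset i k x hk hxR⟩, hk⟩
    · rintro ⟨q, hq, hxq⟩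
      obtain ⟨hqQ, hqR⟩ := Finset.mem_filter.mp hq
      obtain ⟨k, -, rfl⟩ := Finset.mem_image.mp hqQ
      exact ⟨hqR hxq, fun j => (hxq j).1⟩
end

section
/- Let L be a firewall rule list over d fields whose rules have pairwise disjoint boxes (the boxes of any two distinct rules in the list are disjoint sets). Then for every permutation L' of L, the decision function of L' equals the decision function of L on every packet x ∈ ℕ^d. -/
/-- A firewall action: accept or deny. -/
inductive FwAction : Type
  | accept : FwAction
  | deny : FwAction

/-- A firewall rule: a box predicate together with an action. -/
abbrev FwRule (d : ℕ) := Set (Fin d → ℕ) × FwAction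

/-- The decision of a firewall rule list on a packet: the action of the first rule
whose box contains the packet, `deny` if no rule matches. -/
noncomputable def fwDecide {d : ℕ} : List (FwRule d) → (Fin d → ℕ) → FwAction
  | [], _ => FwAction.deny
  | (P, act) :: tl, x =>
      haveI := Classical.propDecidable (x ∈ P)
      if x ∈ P then act else fwDecide tl x

/-- If the boxes of the rules of a firewall rule list are pairwise disjoint, then
the decision function is invariant under permuting the rule list. -/
theorem firewall_rules_commute (d : ℕ) (L L' : List (FwRule d))
    (hdisj : L.Pairwise fun r s => Disjoint r.1 s.1)
    (hperm : L.Perm L') :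
    ∀ x : Fin d → ℕ, fwDecide L' x = fwDecide L x := by
  intro x
  induction hperm with
  | nil => rfl
  | cons r _ ih =>
    simp only [fwDecide]
    rw [ih hdisj.of_cons]
  | swap r s l =>
    have hrs : Disjoint s.1 r.1 := List.rel_of_pairwise_cons hdisj List.mem_cons_self
    simp only [fwDecide]
    by_cases hr : x ∈ r.1
    · have hs : x ∉ s.1 := Set.disjoint_right.mp hrs hr
      simp [hr, hs]
    · simp [hr]
  | trans h₁ _ ih₁ ih₂ =>
    exact (ih₂ (h₁.pairwise hdisj fun h => h.symm)).trans (ih₁ hdisj)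
end

section
/- Let B₁ and B₂ be boxes in ℕ^d. Then the set difference B₁ \ B₂ is the union of at most 2d pairwise disjoint boxes. -/
theorem isBox_setOf_forall {d : ℕ} {P : Fin d → ℕ → Prop}
    (h : ∀ i, ∃ a b : ℕ, ∀ n, P i n ↔ a ≤ n ∧ n ≤ b) : IsBox {x | ∀ i, P i (x i)} := by
  choose a b hab using h
  exact ⟨a, b, by simp only [hab]⟩

/-- The points of the box `[a, b]` whose first coordinate outside `[c, e]` is the `p.1`-th one,
lying below `c` if `p.2 = true` and above `e` (and not below `c`) otherwise. -/
def boxDiffPiece {d : ℕ} (a b c e : Fin d → ℕ) (p : Fin d × Bool) : Set (Fin d → ℕ) :=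
  {x | ∀ j, (a j ≤ x j ∧ x j ≤ b j) ∧ (j < p.1 → c j ≤ x j ∧ x j ≤ e j) ∧
    (j = p.1 → if p.2 then x j < c j else c j ≤ x j ∧ e j < x j)}

theorem isBox_boxDiffPiece {d : ℕ} (a b c e : Fin d → ℕ) (p : Fin d × Bool) :
    IsBox (boxDiffPiece a b c e p) := by
  obtain ⟨i, s⟩ := p
  refine isBox_setOf_forall (P := fun j n => (a j ≤ n ∧ n ≤ b j) ∧
    (j < i → c j ≤ n ∧ n ≤ e j) ∧
    (j = i → if s then n < c j else c j ≤ n ∧ e j < n)) fun j => ?_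
  rcases lt_trichotomy j i with h | rfl | h
  · refine ⟨max (a j) (c j), min (b j) (e j), fun n => ?_⟩
    simp only [h, h.ne, true_imp_iff, false_imp_iff, and_true]
    omega
  · cases s
    · refine ⟨max (a j) (max (c j) (e j + 1)), b j, fun n => ?_⟩
      simp
      omega
    · refine ⟨max (a j) (1 - c j), min (b j) (c j - 1), fun n => ?_⟩
      simp
      omega
  · refine ⟨a j, b j, fun n => ?_⟩
    simp [h.not_gt, h.ne']

theorem disjoint_boxDiffPiece {d : ℕ} (a b c e : Fin d → ℕ) {p q : Fin d × Bool} (hpq : p ≠ q) :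
    Disjoint (boxDiffPiece a b c e p) (boxDiffPiece a b c e q) := by
  rw [Set.disjoint_left]
  intro x hp hq
  obtain ⟨i, s⟩ := p
  obtain ⟨k, t⟩ := q
  have hpi := (hp i).2.2 rfl
  have hqk := (hq k).2.2 rfl
  rcases lt_trichotomy i k with h | rfl | h
  · have := (hq i).2.1 h
    cases s <;> simp at hpi <;> omega
  · cases s <;> cases t <;> simp at hpi hqk hpq <;> omega
  · have := (hp k).2.1 h
    cases t <;> simp at hqk <;> omega

theorem iUnion_boxDiffPiece {d : ℕ} (a b c e : Fin d → ℕ) :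
    ⋃ p, boxDiffPiece a b c e p =
      {x | ∀ i, a i ≤ x i ∧ x i ≤ b i} \ {x | ∀ i, c i ≤ x i ∧ x i ≤ e i} := by
  ext x
  simp only [Set.mem_iUnion, Set.mem_sdiff, Set.mem_ofPred_eq]
  constructor
  · rintro ⟨⟨i, s⟩, hx⟩
    refine ⟨fun j => (hx j).1, fun hall => ?_⟩
    have hi := (hx i).2.2 rfl
    have := hall i
    cases s <;> simp at hi <;> omega
  · rintro ⟨hab, hce⟩
    push Not at hce
    obtain ⟨i, hi, hmin⟩ :=
      WellFounded.has_min wellFounded_lt {i | c i ≤ x i → e i < x i} hce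
    refine ⟨(i, decide (x i < c i)), fun j => ⟨hab j, fun hj => ?_, ?_⟩⟩
    · by_contra hcon
      exact hmin j (fun h => by omega) hj
    · rintro rfl
      have hi' : c j ≤ x j → e j < x j := hi
      by_cases h : x j < c j <;> simp [h]
      omega

/-- The difference of two boxes in `ℕ^d` is the union of at most `2d` pairwise
disjoint boxes. -/
theorem box_diff (d : ℕ) (B₁ B₂ : Set (Fin d → ℕ)) (h₁ : IsBox B₁) (h₂ : IsBox B₂) :
    ∃ Q : Finset (Set (Fin d → ℕ)),
      Q.card ≤ 2 * d ∧
      (∀ q ∈ Q, IsBox q) ∧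
      (Q : Set (Set (Fin d → ℕ))).PairwiseDisjoint id ∧
      B₁ \ B₂ = ⋃₀ ↑Q := by
  classical
  obtain ⟨a, b, rfl⟩ := h₁
  obtain ⟨c, e, rfl⟩ := h₂
  refine ⟨Finset.univ.image (boxDiffPiece a b c e), ?_, ?_, ?_, ?_⟩
  · refine Finset.card_image_le.trans ?_
    simp [mul_comm]
  · simp only [Finset.mem_image, Finset.mem_univ, true_and]
    rintro _ ⟨p, rfl⟩
    exact isBox_boxDiffPiece a b c e p
  · simp only [Finset.coe_image, Finset.coe_univ, Set.image_univ]
    rintro _ ⟨p, rfl⟩ _ ⟨q, rfl⟩ hpq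
    exact disjoint_boxDiffPiece a b c e fun h => hpq (h ▸ rfl)
  · rw [Finset.coe_image, Finset.coe_univ, Set.image_univ, Set.sUnion_range, iUnion_boxDiffPiece]
end

section
/- Fix n and define f : (Fin (2n) → Bool) → Prop by f x ↔ for every i : Fin n, x(2i) = true or x(2i+1) = true. Then for every finite set S of cubes over Fin (2n) such that for all x : Fin (2n) → Bool, f x holds if and only if x extends some cube in S, we have |S| ≥ 2^n. (The conjunction of n disjoint two-variable disjunctions, an n-clause CNF, requires at least 2^n terms in any DNF representation.) -/
/-- The assignment on `2n` variables making exactly one variable of each pair true: `2i` if `a i`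
holds, and `2i+1` otherwise. -/
def pairAssignment {n : ℕ} (a : Fin n → Bool) (j : Fin (2 * n)) : Bool :=
  a ⟨j.val / 2, by have := j.isLt; omega⟩ ^^ decide (j.val % 2 = 1)

theorem pairAssignment_even {n : ℕ} (a : Fin n → Bool) (i : Fin n) (h : 2 * i.val < 2 * n) :
    pairAssignment a ⟨2 * i.val, h⟩ = a i := by
  simp [pairAssignment]

theorem pairAssignment_odd {n : ℕ} (a : Fin n → Bool) (i : Fin n) (h : 2 * i.val + 1 < 2 * n) :
    pairAssignment a ⟨2 * i.val + 1, h⟩ = !a i := by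
  have h2 : (2 * i.val + 1) / 2 = i.val := by omega
  simp [pairAssignment, h2, Nat.add_mod]

theorem pairAssignment_ne {n : ℕ} {a b : Fin n → Bool} {i : Fin n} (hab : a i ≠ b i)
    {j : Fin (2 * n)} (hj : j.val / 2 = i.val) : pairAssignment a j ≠ pairAssignment b j := by
  simpa [pairAssignment, hj] using hab

/-- The n-clause CNF `⋀ i, (x (2i) ∨ x (2i+1))` on `2n` variables requires at
least `2^n` cubes in any DNF representation. -/
theorem dnf_lower_bound (n : ℕ) (S : Finset (Fin (2 * n) → Option Bool))
    (hS : ∀ x : Fin (2 * n) → Bool,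
      (∀ i : Fin n,
          x ⟨2 * i.val, by have := i.isLt; omega⟩ = true ∨
          x ⟨2 * i.val + 1, by have := i.isLt; omega⟩ = true) ↔
        ∃ c ∈ S, ∀ (j : Fin (2 * n)) (v : Bool), c j = some v → x j = v) :
    2 ^ n ≤ S.card := by
  have hcover : ∀ a : Fin n → Bool, ∃ c ∈ S, ∀ (j : Fin (2 * n)) (v : Bool),
      c j = some v → pairAssignment a j = v := fun a => (hS _).1 fun i => by
    rw [pairAssignment_even, pairAssignment_odd]
    cases a i <;> simp
  choose c hcS hc using hcover
  have hinj : Function.Injective c := by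
    intro a b hab
    by_contra hne
    obtain ⟨i, hi⟩ := Function.ne_iff.1 hne
    -- The common cube leaves both variables of pair `i` free, so they can be set to false.
    have hfalse := (hS fun j => if j.val / 2 = i.val then false else pairAssignment a j).2
      ⟨c a, hcS a, fun j v hv => by
        have hj : j.val / 2 ≠ i.val := fun hj =>
          pairAssignment_ne hi hj ((hc a j v hv).trans (hc b j v (hab ▸ hv)).symm)
        simpa [hj] using hc a j v hv⟩ i
    have h2 : (2 * i.val + 1) / 2 = i.val := by omega
    simp [h2] at hfalse
  calc 2 ^ n = (Finset.univ : Finset (Fin n → Bool)).card := by simp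
    _ ≤ S.card := Finset.card_le_card_of_injOn c (fun a _ => hcS a) hinj.injOn
end
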